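/- arXiv:1503.01031 — 2 statements merged into one kernel-verified Lean document; each statement's English description precedes it below -/
import Mathlib

section
/- Let 0 < t₁ < t₂ < π, q ∈ (−1, 1), and suppose t₁*, t₂* ∈ (0, π) satisfy T_q(e^{it₁}) = e^{it₁*} and T_q(e^{it₂}) = e^{it₂*}, where T_q(z) = (z − q)/(1 − qz). Then for every z ∈ 𝔻, ψ_{1,(t₁,t₂)}(z) = ψ_{1,(t₁*,t₂*)}(T_q(z)) · (T_q'(z))². -/
noncomputable def ψ₁ (t₁ t₂ : ℝ) (z : ℂ) : ℂ :=
  4 * (Real.cos t₂ - Real.cos t₁) /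
    ((z ^ 2 - 2 * z * Real.cos t₁ + 1) * (z ^ 2 - 2 * z * Real.cos t₂ + 1))

noncomputable def ψ₀ (t₁ t₂ : ℝ) (z : ℂ) : ℂ :=
  (((3 * Real.cos (2 * t₁) - 5 * Real.cos (2 * t₂) + 2) / 8) * z ^ 4
    + (3 * Real.sin t₁ ^ 2 * Real.cos t₂ - 5 * Real.cos t₁ * Real.sin t₂ ^ 2) * z ^ 3
    + ((Real.cos (2 * t₁) * (11 - 2 * Real.cos (2 * t₂)) - 13 * Real.cos (2 * t₂) + 4) / 4) * z ^ 2
    + (3 * Real.sin t₁ ^ 2 * Real.cos t₂ - 5 * Real.cos t₁ * Real.sin t₂ ^ 2) * z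
    + ((3 * Real.cos (2 * t₁) - 5 * Real.cos (2 * t₂) + 2) / 8)) /
  ((z ^ 2 - 2 * z * Real.cos t₁ + 1) ^ 2 * (z ^ 2 - 2 * z * Real.cos t₂ + 1) ^ 2)

/-- The Möbius self-map `T_q(z) = (z - q)/(1 - qz)` of the unit disk. -/
noncomputable def T (q z : ℂ) : ℂ := (z - q) / (1 - q * z)

/-- The real form of the relation `T_q(e^{it}) = e^{is}`. -/
theorem cos_mul_eq_of_T_exp_eq {q t s : ℝ}
    (h : T q (Complex.exp (t * Complex.I)) = Complex.exp (s * Complex.I)) :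
    Real.cos s * (1 - 2 * q * Real.cos t + q ^ 2) = (1 + q ^ 2) * Real.cos t - 2 * q := by
  have hden : 1 - (q : ℂ) * Complex.exp (t * Complex.I) ≠ 0 := by
    intro h0
    rw [T, h0, div_zero] at h
    exact Complex.exp_ne_zero _ h.symm
  rw [T, div_eq_iff hden] at h
  have hre := congrArg Complex.re h
  have him := congrArg Complex.im h
  simp only [Complex.sub_re, Complex.sub_im, Complex.mul_re, Complex.mul_im, Complex.one_re,
    Complex.one_im, Complex.exp_ofReal_mul_I_re, Complex.exp_ofReal_mul_I_im, Complex.ofReal_re,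
    Complex.ofReal_im] at hre him
  linear_combination (-(1 - q * Real.cos t)) * hre + q * Real.sin t * him
    + (-(q ^ 2 * Real.cos s) - q) * Real.sin_sq_add_cos_sq t

theorem one_sub_two_mul_cos_add_sq_pos {q : ℝ} (hq : q ∈ Set.Ioo (-1 : ℝ) 1) (t : ℝ) :
    0 < 1 - 2 * q * Real.cos t + q ^ 2 := by
  obtain ⟨hq₁, hq₂⟩ := hq
  have hq₃ : 0 < 1 - q ^ 2 := by nlinarith
  nlinarith [sq_nonneg (q - Real.cos t), Real.cos_sq_le_one t, sq_nonneg (1 - q * Real.cos t)]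

theorem one_sub_mul_ne_zero {q : ℝ} (hq : q ∈ Set.Ioo (-1 : ℝ) 1) {z : ℂ} (hz : ‖z‖ < 1) :
    1 - (q : ℂ) * z ≠ 0 := by
  intro h
  have hn : ‖(q : ℂ) * z‖ = 1 := by rw [← sub_eq_zero.mp h, norm_one]
  rw [norm_mul, Complex.norm_real, Real.norm_eq_abs] at hn
  have hq' : |q| < 1 := abs_lt.mpr hq
  nlinarith [abs_nonneg q, norm_nonneg z]

theorem hasDerivAt_T {q z : ℂ} (hz : 1 - q * z ≠ 0) :
    HasDerivAt (T q) ((1 - q ^ 2) / (1 - q * z) ^ 2) z := by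
  have hnum : HasDerivAt (fun w : ℂ => w - q) 1 z := (hasDerivAt_id z).sub_const q
  have hden : HasDerivAt (fun w : ℂ => 1 - q * w) (-(q * 1)) z :=
    ((hasDerivAt_id z).const_mul q).const_sub 1
  exact (hnum.div hden hz).congr_deriv (by ring)

theorem T_quadratic_eq {q z c d : ℂ} (hz : 1 - q * z ≠ 0) (hD : 1 - 2 * q * c + q ^ 2 ≠ 0)
    (h : d * (1 - 2 * q * c + q ^ 2) = (1 + q ^ 2) * c - 2 * q) :
    T q z ^ 2 - 2 * T q z * d + 1 =
      (1 - q ^ 2) ^ 2 / ((1 - 2 * q * c + q ^ 2) * (1 - q * z) ^ 2) * (z ^ 2 - 2 * z * c + 1) := by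
  rw [eq_div_of_mul_eq hD h, T]
  generalize hE : 1 - 2 * q * c + q ^ 2 = E at hD ⊢
  generalize hW : 1 - q * z = W at hz ⊢
  field_simp
  subst hE hW
  ring

theorem psi1_pullback
    (t₁ t₂ t₁s t₂s q : ℝ)
    (ht₁ : 0 < t₁) (ht₁₂ : t₁ < t₂) (ht₂ : t₂ < Real.pi)
    (hq : q ∈ Set.Ioo (-1 : ℝ) 1)
    (ht₁s : t₁s ∈ Set.Ioo 0 Real.pi) (ht₂s : t₂s ∈ Set.Ioo 0 Real.pi)
    (hT1 : T q (Complex.exp (t₁ * Complex.I)) = Complex.exp (t₁s * Complex.I))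
    (hT2 : T q (Complex.exp (t₂ * Complex.I)) = Complex.exp (t₂s * Complex.I)) :
    ∀ z ∈ Metric.ball (0 : ℂ) 1,
      ψ₁ t₁ t₂ z = ψ₁ t₁s t₂s (T q z) * (deriv (T q) z) ^ 2 := by
  intro z hz
  have hz₀ := one_sub_mul_ne_zero hq (mem_ball_zero_iff.mp hz)
  have hD : ∀ t : ℝ, 1 - 2 * (q : ℂ) * Real.cos t + (q : ℂ) ^ 2 ≠ 0 := fun t => by
    exact_mod_cast (one_sub_two_mul_cos_add_sq_pos hq t).ne'
  have hc : ∀ {t s : ℝ}, T q (Complex.exp (t * Complex.I)) = Complex.exp (s * Complex.I) →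
      (Real.cos s : ℂ) * (1 - 2 * q * Real.cos t + q ^ 2) =
        (1 + q ^ 2) * Real.cos t - 2 * q := fun h => by
    exact_mod_cast cos_mul_eq_of_T_exp_eq h
  have hq₀ : 1 - (q : ℂ) ^ 2 ≠ 0 := by
    have : 1 - q ^ 2 ≠ 0 := by nlinarith [hq.1, hq.2]
    exact_mod_cast this
  have hD₁ := hD t₁
  have hD₂ := hD t₂
  rw [(hasDerivAt_T hz₀).deriv, ψ₁, ψ₁, T_quadratic_eq hz₀ hD₁ (hc hT1),
    T_quadratic_eq hz₀ hD₂ (hc hT2), eq_div_of_mul_eq hD₁ (hc hT1),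
    eq_div_of_mul_eq hD₂ (hc hT2)]
  generalize (Real.cos t₁ : ℂ) = c₁ at *
  generalize (Real.cos t₂ : ℂ) = c₂ at *
  generalize hE₁ : 1 - 2 * (q : ℂ) * c₁ + q ^ 2 = E₁ at hD₁ ⊢
  generalize hE₂ : 1 - 2 * (q : ℂ) * c₂ + q ^ 2 = E₂ at hD₂ ⊢
  have hdiff : ((1 + (q : ℂ) ^ 2) * c₂ - 2 * q) / E₂ - ((1 + (q : ℂ) ^ 2) * c₁ - 2 * q) / E₁ =
      (1 - q ^ 2) ^ 2 * (c₂ - c₁) / (E₁ * E₂) := by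
    field_simp
    subst hE₁ hE₂
    ring
  rw [hdiff]
  generalize z ^ 2 - 2 * z * c₁ + 1 = P₁
  generalize z ^ 2 - 2 * z * c₂ + 1 = P₂
  field_simp
end

section
/- Let t ∈ (0, π/2) and λ ∈ ℝ. If there exists a holomorphic injective function f on 𝔻 whose Schwarzian derivative satisfies S_f(z) = R_{t,λ}(z) for all z ∈ 𝔻, then −(13 − cos 2t)/(32 cos t) ≤ λ ≤ (11 + cos 2t)/(32 cos t). -/
/-- The Schwarzian derivative `S_f = f'''/f' - (3/2)(f''/f')²`. -/
noncomputable def schwarzian (f : ℂ → ℂ) (z : ℂ) : ℂ :=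
  deriv (deriv (deriv f)) z / deriv f z - (3 / 2) * (deriv (deriv f) z / deriv f z) ^ 2

noncomputable def ψ₀t (t : ℝ) (z : ℂ) : ℂ :=
  Real.sin t ^ 2 *
      (z ^ 4 - (16 * Real.cos t) * z ^ 3 + (4 + 2 * Real.cos (2 * t)) * z ^ 2
        - (16 * Real.cos t) * z + 1) /
    (2 * (z ^ 4 - (2 * Real.cos (2 * t)) * z ^ 2 + 1) ^ 2)

noncomputable def ψ₁t (t : ℝ) (z : ℂ) : ℂ :=
  -8 * Real.cos t / (z ^ 4 - (2 * Real.cos (2 * t)) * z ^ 2 + 1)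

/-- The rational function `R_{t,λ} = 2ψ₀,t - 2λψ₁,t`. -/
noncomputable def Rt (t lam : ℝ) (z : ℂ) : ℂ :=
  2 * ψ₀t t z - 2 * lam * ψ₁t t z

open Set Metric Filter Topology MeasureTheory

theorem abs_det_restrictScalars_toSpanSingleton (c : ℂ) :
    |((ContinuousLinearMap.toSpanSingleton ℂ c).restrictScalars ℝ : ℂ →L[ℝ] ℂ).det| = ‖c‖ ^ 2 := by
  simp [ContinuousLinearMap.det, LinearMap.det_restrictScalars, Algebra.norm_complex_eq,
    Complex.normSq_eq_norm_sq]

/-- The real-linear map `w ↦ w - c * conj w`. -/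
noncomputable def subMulConj (c : ℂ) : ℂ →L[ℝ] ℂ :=
  ContinuousLinearMap.id ℝ ℂ - (c • (Complex.conjCLE : ℂ →L[ℝ] ℂ))

theorem subMulConj_apply (c w : ℂ) : subMulConj c w = w - c * starRingEnd ℂ w := by
  simp [subMulConj]

theorem det_subMulConj (c : ℂ) :
    LinearMap.det (subMulConj c : ℂ →ₗ[ℝ] ℂ) = 1 - ‖c‖ ^ 2 := by
  rw [← LinearMap.det_toMatrix Complex.basisOneI, Matrix.det_fin_two]
  simp [LinearMap.toMatrix_apply, subMulConj_apply, Complex.basisOneI, ← Complex.normSq_eq_norm_sq,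
    Complex.normSq_apply]
  ring

theorem volume_norm_subMulConj_sub_le {c : ℂ} (hc : ‖c‖ < 1) (b : ℂ) {ρ : ℝ} (hρ : 0 ≤ ρ) :
    volume {w : ℂ | ‖subMulConj c (w - b)‖ ≤ ρ} =
      ENNReal.ofReal (Real.pi * ρ ^ 2 / (1 - ‖c‖ ^ 2)) := by
  have hd : 0 < 1 - ‖c‖ ^ 2 := by nlinarith [norm_nonneg c]
  have hset : {w : ℂ | ‖subMulConj c (w - b)‖ ≤ ρ} =
      subMulConj c ⁻¹' closedBall (subMulConj c b) ρ := by
    ext w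
    simp [dist_eq_norm]
  rw [hset, Measure.addHaar_preimage_continuousLinearMap _ (by rw [det_subMulConj]; exact hd.ne'),
    det_subMulConj, Complex.volume_closedBall, abs_of_pos (inv_pos.2 hd), ← ENNReal.ofReal_pow hρ,
    ← NNReal.coe_real_pi, ENNReal.ofReal_div_of_pos hd, ENNReal.ofReal_mul (by positivity),
    ENNReal.ofReal_coe_nnreal, ENNReal.ofReal_inv_of_pos hd, ENNReal.div_eq_inv_mul,
    mul_comm (NNReal.pi : ENNReal)]

theorem norm_inv_sub_le_of_annulus {f : ℂ → ℂ} (hf : DifferentiableOn ℂ f (ball 0 1))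
    (hinj : InjOn f (ball 0 1)) (h0 : f 0 = 0) {r : ℝ} (hr : 0 < r) (L : ℂ →L[ℝ] ℂ) {b : ℂ}
    {ρ : ℝ} (hb : ‖L b‖ ≤ ρ) (hs : ∀ z, ‖z‖ = r → ‖L ((f z)⁻¹ - b)‖ ≤ ρ)
    {z : ℂ} (hrz : r < ‖z‖) (hz1 : ‖z‖ < 1) : ‖L ((f z)⁻¹ - b)‖ ≤ ρ := by
  by_contra! hlt
  have hr1 : r < 1 := hrz.trans hz1
  have hsub : closedBall (0 : ℂ) r ⊆ ball 0 1 := closedBall_subset_ball hr1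
  have hopen : IsOpen (f '' ball 0 r) := by
    refine ((hf.analyticOnNhd isOpen_ball).is_constant_or_isOpen
      (convex_ball _ _).isPreconnected).resolve_left ?_ _ (ball_subset_ball hr1.le) isOpen_ball
    rintro ⟨w, hw⟩
    have hz' : z ∈ ball (0 : ℂ) 1 := by simpa using hz1
    have h0' : (0 : ℂ) ∈ ball (0 : ℂ) 1 := by simp
    have := hinj hz' h0' ((hw z hz').trans (hw 0 h0').symm)
    simp [this] at hrz
    linarith
  have hclosed : IsClosed (f '' closedBall 0 r) :=
    ((isCompact_closedBall _ _).image_of_continuousOn (hf.continuousOn.mono hsub)).isClosed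
  set u := (f z)⁻¹ - b with hu
  have hLu : ∀ τ : ℝ, 1 ≤ τ → ρ < ‖L (τ • u)‖ := fun τ hτ ↦ by
    rw [map_smul, norm_smul, Real.norm_of_nonneg (by linarith)]
    nlinarith [norm_nonneg (L u)]
  have hne : ∀ τ : ℝ, 1 ≤ τ → b + τ • u ≠ 0 := fun τ hτ h ↦ by
    have h1 := hLu τ hτ
    rw [eq_neg_of_add_eq_zero_right h, map_neg, norm_neg] at h1
    linarith
  have hu0 : u ≠ 0 := by
    rintro h
    rw [h, map_zero, norm_zero] at hlt
    linarith [norm_nonneg (L b)]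
  let v : ℝ → ℂ := fun τ ↦ (b + τ • u)⁻¹
  have hv : ContinuousOn v (Ici 1) :=
    ContinuousOn.inv₀ (by fun_prop) fun τ hτ ↦ hne τ hτ
  have hlim : Tendsto v atTop (𝓝 0) := by
    refine tendsto_inv₀_cobounded.comp ?_
    rw [← tendsto_norm_atTop_iff_cobounded]
    refine tendsto_atTop_mono (f := fun τ : ℝ ↦ τ * ‖u‖ - ‖b‖) (fun τ ↦ ?_) ?_
    · have h1 := norm_sub_le (b + τ • u) b
      rw [add_sub_cancel_left, norm_smul] at h1
      have h2 := mul_le_mul_of_nonneg_right (Real.le_norm_self τ) (norm_nonneg u)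
      linarith
    · exact tendsto_atTop_add_const_right _ _ (tendsto_id.atTop_mul_const (norm_pos_iff.2 hu0))
  have hpre : IsPreconnected (v '' Ici 1) := isPreconnected_Ici.image _ hv
  have hdisj : Disjoint (f '' ball 0 r) (f '' closedBall 0 r)ᶜ :=
    disjoint_compl_right_iff_subset.2 (image_mono ball_subset_closedBall)
  have hcover : v '' Ici 1 ⊆ f '' ball 0 r ∪ (f '' closedBall 0 r)ᶜ := by
    rintro _ ⟨τ, hτ, rfl⟩
    by_contra hmem
    simp only [mem_union, not_or, mem_compl_iff, not_not] at hmem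
    obtain ⟨hnot, x, hx, hxv⟩ := hmem
    have hxr : ‖x‖ = r := by
      refine le_antisymm (by simpa using hx) (not_lt.1 fun h ↦ hnot ⟨x, by simpa using h, hxv⟩)
    have h1 := hs x hxr
    rw [hxv] at h1
    simp only [v, inv_inv, add_sub_cancel_left] at h1
    exact absurd h1 (not_le.2 (hLu τ hτ))
  have hnonempty : (v '' Ici 1 ∩ f '' ball 0 r).Nonempty := by
    have hnhds : f '' ball 0 r ∈ 𝓝 (0 : ℂ) := hopen.mem_nhds ⟨0, by simpa using hr, h0⟩
    obtain ⟨τ, hτ, hτ1⟩ := ((hlim.eventually hnhds).and (eventually_ge_atTop 1)).exists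
    exact ⟨v τ, ⟨τ, hτ1, rfl⟩, hτ⟩
  obtain ⟨x, hx, hxv⟩ := hpre.subset_left_of_subset_union hopen hclosed.isOpen_compl hdisj hcover
    hnonempty ⟨1, self_mem_Ici, rfl⟩
  have hxz : x = z := by
    refine hinj (hsub (ball_subset_closedBall hx)) (by simpa using hz1) ?_
    rw [hxv]
    simp [v, hu]
  rw [hxz, mem_ball_zero_iff] at hx
  linarith

theorem two_pi_mul_le_integral_norm_sq {ψ : ℂ → ℂ} (hψ : DifferentiableOn ℂ ψ (ball 0 1))
    {s : ℝ} (hs : 0 < s) (hs1 : s < 1) :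
    2 * Real.pi * (s⁻¹ ^ 4 + ‖ψ 0‖ ^ 2) ≤
      ∫ θ in -Real.pi..Real.pi,
        ‖-((circleMap 0 s θ) ^ 2)⁻¹ + ψ (circleMap 0 s θ)‖ ^ 2 := by
  set b := ψ 0
  let g : ℂ → ℂ := fun z ↦ -2 * (s⁻¹ : ℂ) ^ 4 * z ^ 2 * ψ z + 2 * starRingEnd ℂ b * ψ z
  have hsub : closedBall (0 : ℂ) s ⊆ ball 0 1 := closedBall_subset_ball hs1
  have hg : DifferentiableOn ℂ g (ball 0 1) := by
    fun_prop
  have hmean : Real.circleAverage g 0 s = g 0 := by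
    apply DiffContOnCl.circleAverage
    rw [abs_of_pos hs]
    refine DifferentiableOn.diffContOnCl (hg.mono ?_)
    rw [closure_ball _ hs.ne']
    exact hsub
  have hmaps : ∀ θ, circleMap 0 s θ ∈ ball (0 : ℂ) 1 := fun θ ↦
    hsub (sphere_subset_closedBall (circleMap_mem_sphere _ hs.le θ))
  have hcomp : ∀ {F : ℂ → ℂ}, ContinuousOn F (ball 0 1) → Continuous fun θ ↦ F (circleMap 0 s θ) :=
    fun hF ↦ hF.comp_continuous (continuous_circleMap 0 s) hmaps
  have hgc := hcomp hg.continuousOn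
  have hψc := hcomp hψ.continuousOn
  have hint : ∫ θ in -Real.pi..Real.pi, g (circleMap 0 s θ) = 2 * Real.pi * g 0 := by
    have hper : Function.Periodic (fun θ ↦ g (circleMap 0 s θ)) (2 * Real.pi) :=
      fun θ ↦ by simp [periodic_circleMap 0 s θ]
    have h1 := hper.intervalIntegral_add_eq (-Real.pi) 0
    rw [show -Real.pi + 2 * Real.pi = Real.pi by ring, zero_add] at h1
    rw [h1, ← hmean, Real.circleAverage_def, Complex.real_smul]
    push_cast
    field_simp
  have hre : ∫ θ in -Real.pi..Real.pi, (g (circleMap 0 s θ)).re = 2 * Real.pi * (2 * ‖b‖ ^ 2) := by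
    have h1 := intervalIntegral.intervalIntegral_re (𝕜 := ℂ)
      (hgc.intervalIntegrable (μ := volume) (-Real.pi) Real.pi)
    simp only [RCLike.re_to_complex] at h1
    rw [h1, hint]
    have : g 0 = ((2 * ‖b‖ ^ 2 : ℝ) : ℂ) := by
      simp [g, mul_assoc, b, Complex.conj_mul']
    rw [this]
    norm_cast
  have hpt : ∀ θ, (s⁻¹ ^ 4 - ‖b‖ ^ 2) + (g (circleMap 0 s θ)).re ≤
      ‖-((circleMap 0 s θ) ^ 2)⁻¹ + ψ (circleMap 0 s θ)‖ ^ 2 := fun θ ↦ by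
    have hz : ‖circleMap 0 s θ‖ = s := by simp [abs_of_pos hs]
    set z := circleMap 0 s θ
    have hz0 : z ≠ 0 := norm_pos_iff.1 (hz ▸ hs)
    have hinv : starRingEnd ℂ ((z ^ 2)⁻¹) = (s⁻¹ : ℂ) ^ 4 * z ^ 2 := by
      rw [map_inv₀, map_pow]
      have := Complex.mul_conj' z
      rw [hz] at this
      have hs0 : (s : ℂ) ≠ 0 := by exact_mod_cast hs.ne'
      have hc0 : starRingEnd ℂ z ≠ 0 := by simpa using hz0
      field_simp
      rw [show (s : ℂ) ^ 4 = (s ^ 2) ^ 2 by ring, ← this]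
      ring
    have hnorm : ‖(z ^ 2)⁻¹‖ ^ 2 = s⁻¹ ^ 4 := by
      rw [norm_inv, norm_pow, hz]
      ring
    have h1 : ‖-(z ^ 2)⁻¹ + ψ z‖ ^ 2 = ‖(z ^ 2)⁻¹‖ ^ 2 + ‖ψ z‖ ^ 2
        - 2 * (starRingEnd ℂ ((z ^ 2)⁻¹) * ψ z).re := by
      simp only [← Complex.normSq_eq_norm_sq, Complex.normSq_apply, Complex.add_re, Complex.add_im,
        Complex.neg_re, Complex.neg_im, Complex.mul_re, Complex.conj_re, Complex.conj_im]
      ring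
    have h2 : 0 ≤ ‖ψ z‖ ^ 2 + ‖b‖ ^ 2 - 2 * (starRingEnd ℂ b * ψ z).re := by
      have : ‖ψ z‖ ^ 2 + ‖b‖ ^ 2 - 2 * (starRingEnd ℂ b * ψ z).re = ‖ψ z - b‖ ^ 2 := by
        simp only [← Complex.normSq_eq_norm_sq, Complex.normSq_apply, Complex.sub_re,
          Complex.sub_im, Complex.mul_re, Complex.conj_re, Complex.conj_im]
        ring
      rw [this]
      positivity
    have h3 : (g z).re = -2 * (starRingEnd ℂ ((z ^ 2)⁻¹) * ψ z).re
        + 2 * (starRingEnd ℂ b * ψ z).re := by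
      rw [hinv]
      have : g z = ((-2 : ℝ) : ℂ) * ((s⁻¹ : ℂ) ^ 4 * z ^ 2 * ψ z)
          + ((2 : ℝ) : ℂ) * (starRingEnd ℂ b * ψ z) := by
        simp only [g]
        push_cast
        ring
      rw [this, Complex.add_re, Complex.re_ofReal_mul, Complex.re_ofReal_mul]
    rw [h1, h3, hnorm]
    linarith
  have hgre : Continuous fun θ ↦ (g (circleMap 0 s θ)).re := Complex.continuous_re.comp hgc
  have hne : ∀ θ, circleMap 0 s θ ^ 2 ≠ 0 := fun θ ↦ pow_ne_zero _ (circleMap_ne_center hs.ne')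
  have hle := intervalIntegral.integral_mono (μ := volume) (a := -Real.pi) (b := Real.pi)
    (by linarith [Real.pi_pos])
    ((continuous_const.add hgre).intervalIntegrable _ _)
    (Continuous.intervalIntegrable
      ((((continuous_circleMap 0 s).pow 2).inv₀ hne).neg.add hψc |>.norm.pow 2) _ _) hpt
  refine le_trans (le_of_eq ?_) hle
  simp only [Pi.add_apply]
  rw [intervalIntegral.integral_add (by simp) (hgre.intervalIntegrable _ _),
    hre, intervalIntegral.integral_const, smul_eq_mul]
  ring

theorem le_lintegral_mul_norm_sq {ψ : ℂ → ℂ} (hψ : DifferentiableOn ℂ ψ (ball 0 1))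
    {s : ℝ} (hs : 0 < s) (hs1 : s < 1) :
    ENNReal.ofReal (s * (2 * Real.pi * (s⁻¹ ^ 4 + ‖ψ 0‖ ^ 2))) ≤
      ∫⁻ θ in Ioo (-Real.pi) Real.pi, ENNReal.ofReal s *
        ENNReal.ofReal (‖-((circleMap 0 s θ) ^ 2)⁻¹ + ψ (circleMap 0 s θ)‖ ^ 2) := by
  have hc : Continuous fun θ ↦ ‖-((circleMap 0 s θ) ^ 2)⁻¹ + ψ (circleMap 0 s θ)‖ ^ 2 := by
    refine ((((continuous_circleMap 0 s).pow 2).inv₀ fun θ ↦ ?_).neg.add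
      (hψ.continuousOn.comp_continuous (continuous_circleMap 0 s) fun θ ↦ ?_)).norm.pow 2
    · exact pow_ne_zero _ (circleMap_ne_center hs.ne')
    · exact closedBall_subset_ball hs1 (sphere_subset_closedBall (circleMap_mem_sphere _ hs.le θ))
  have hpi : -Real.pi ≤ Real.pi := by linarith [Real.pi_pos]
  rw [lintegral_const_mul' _ _ ENNReal.ofReal_ne_top, restrict_Ioo_eq_restrict_Ioc,
    ← ofReal_integral_eq_lintegral_ofReal
      ((intervalIntegrable_iff_integrableOn_Ioc_of_le hpi).1 (hc.intervalIntegrable _ _))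
      (Eventually.of_forall fun θ ↦ by positivity),
    ← intervalIntegral.integral_of_le hpi, ENNReal.ofReal_mul hs.le]
  gcongr
  exact two_pi_mul_le_integral_norm_sq hψ hs hs1

theorem integral_mul_inv_pow_four_add {r B : ℝ} (hr : 0 < r) :
    ∫ s in r..1, s * (2 * Real.pi * (s⁻¹ ^ 4 + B)) =
      Real.pi * (r⁻¹ ^ 2 - 1 + B * (1 - r ^ 2)) := by
  have hpos : ∀ s ∈ uIcc r 1, s ≠ 0 := fun s hs ↦
    (lt_of_lt_of_le (lt_min hr one_pos) hs.1).ne'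
  rw [intervalIntegral.integral_eq_sub_of_hasDerivAt
    (f := fun s ↦ Real.pi * (B * s ^ 2 - (s ^ 2)⁻¹))]
  · field_simp
    ring
  · intro s hs
    have hs0 := hpos s hs
    have h1 := (((hasDerivAt_pow 2 s).const_mul B).sub
      ((hasDerivAt_pow 2 s).fun_inv (pow_ne_zero 2 hs0))).const_mul Real.pi
    convert! h1 using 1
    push_cast
    field_simp
    ring
  · refine ContinuousOn.intervalIntegrable ?_
    exact continuousOn_id.mul (continuousOn_const.mul
      (((continuousOn_id.inv₀ hpos).pow 4).add continuousOn_const))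

theorem le_volume_image_annulus {h ψ : ℂ → ℂ} (hψ : DifferentiableOn ℂ ψ (ball 0 1))
    {r : ℝ} (hr : 0 < r) (hr1 : r < 1)
    (hh : ∀ z ∈ ball (0 : ℂ) 1 \ closedBall 0 r, HasDerivAt h (-(z ^ 2)⁻¹ + ψ z) z)
    (hinj : InjOn h (ball 0 1 \ closedBall 0 r)) :
    ENNReal.ofReal (Real.pi * (r⁻¹ ^ 2 - 1 + ‖ψ 0‖ ^ 2 * (1 - r ^ 2))) ≤
      volume (h '' (ball 0 1 \ closedBall 0 r)) := by
  set A := ball (0 : ℂ) 1 \ closedBall 0 r with hA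
  have hAm : MeasurableSet A := measurableSet_ball.diff measurableSet_closedBall
  rw [← lintegral_abs_det_fderiv_eq_addHaar_image volume hAm
    (fun z hz ↦ ((hh z hz).hasFDerivAt.restrictScalars ℝ).hasFDerivWithinAt) hinj]
  simp only [abs_det_restrictScalars_toSpanSingleton]
  rw [← lintegral_indicator hAm, ← Complex.lintegral_comp_polarCoord_symm]
  let F : ℝ × ℝ → ENNReal := fun p ↦ ENNReal.ofReal p.1 *
    ENNReal.ofReal (‖-((circleMap 0 p.1 p.2) ^ 2)⁻¹ + ψ (circleMap 0 p.1 p.2)‖ ^ 2)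
  let T : Set (ℝ × ℝ) := Ioo r 1 ×ˢ Ioo (-Real.pi) Real.pi
  have hTm : MeasurableSet T := measurableSet_Ioo.prod measurableSet_Ioo
  have hT : T ⊆ polarCoord.target := prod_mono (fun s hs ↦ hr.trans hs.1) subset_rfl
  have hFm : AEMeasurable F (volume.restrict T) := by
    have hcm : Continuous fun p : ℝ × ℝ ↦ circleMap 0 p.1 p.2 := by
      simp only [circleMap]
      fun_prop
    have hc : ContinuousOn (fun p : ℝ × ℝ ↦
        ‖-((circleMap 0 p.1 p.2) ^ 2)⁻¹ + ψ (circleMap 0 p.1 p.2)‖ ^ 2) T := by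
      refine (((hcm.continuousOn.pow 2).inv₀ fun p hp ↦ ?_).neg.add
        (hψ.continuousOn.comp hcm.continuousOn fun p hp ↦ ?_)).norm.pow 2
      · exact pow_ne_zero _ (circleMap_ne_center (hr.trans hp.1.1).ne')
      · simpa [abs_of_pos (hr.trans hp.1.1)] using hp.1.2
    exact (by fun_prop : Measurable fun p : ℝ × ℝ ↦ ENNReal.ofReal p.1).aemeasurable.mul
      (hc.aemeasurable hTm).ennreal_ofReal
  calc
    _ = ∫⁻ s in Ioo r 1, ENNReal.ofReal (s * (2 * Real.pi * (s⁻¹ ^ 4 + ‖ψ 0‖ ^ 2))) := by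
      rw [← integral_mul_inv_pow_four_add hr, intervalIntegral.integral_of_le hr1.le,
        restrict_Ioo_eq_restrict_Ioc]
      refine ofReal_integral_eq_lintegral_ofReal ?_ ?_
      · refine (ContinuousOn.integrableOn_Icc ?_).mono_set Ioc_subset_Icc_self
        exact continuousOn_id.mul (continuousOn_const.mul
          (((continuousOn_id.inv₀ fun s hs ↦ (hr.trans_le hs.1).ne').pow 4).add continuousOn_const))
      · filter_upwards [ae_restrict_mem measurableSet_Ioc] with s hs
        have := hr.trans hs.1
        simp only [Pi.zero_apply]
        positivity
    _ ≤ ∫⁻ s in Ioo r 1, ∫⁻ θ in Ioo (-Real.pi) Real.pi, F (s, θ) :=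
      setLIntegral_mono' measurableSet_Ioo fun s hs ↦
        le_lintegral_mul_norm_sq hψ (hr.trans hs.1) hs.2
    _ = ∫⁻ p in T, F p := by
      rw [Measure.volume_eq_prod, ← Measure.prod_restrict, lintegral_prod]
      rwa [Measure.prod_restrict, ← Measure.volume_eq_prod]
    _ = ∫⁻ p in T, ENNReal.ofReal p.1 • A.indicator
          (fun z ↦ ENNReal.ofReal (‖-(z ^ 2)⁻¹ + ψ z‖ ^ 2)) (Complex.polarCoord.symm p) := by
      refine setLIntegral_congr_fun hTm fun p hp ↦ ?_
      have hcirc : Complex.polarCoord.symm p = circleMap 0 p.1 p.2 := by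
        simp [Complex.polarCoord_symm_apply, circleMap, Complex.exp_mul_I]
      have hmem : circleMap 0 p.1 p.2 ∈ A := by
        simpa [hA, abs_of_pos (hr.trans hp.1.1)] using hp.1.symm
      simp only [hcirc, indicator_of_mem hmem, smul_eq_mul, F]
    _ ≤ _ := lintegral_mono_set hT

/-- **Gronwall area theorem**, first coefficient: if `f` is injective and holomorphic on the unit
disc and `1 / f z = 1 / z + a + b * z + O(z ^ 2)`, then `‖b‖ ≤ 1`. -/
theorem norm_le_one_of_injOn_ball {f q : ℂ → ℂ} {a b : ℂ}
    (hf : DifferentiableOn ℂ f (ball 0 1)) (hinj : InjOn f (ball 0 1))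
    (hq : DifferentiableOn ℂ q (ball 0 1))
    (hfq : ∀ z ∈ ball (0 : ℂ) 1, f z * (1 + a * z + b * z ^ 2 + z ^ 3 * q z) = z) :
    ‖b‖ ≤ 1 := by
  have h0 : f 0 = 0 := by simpa using hfq 0 (by simp)
  have hinv : ∀ z ∈ ball (0 : ℂ) 1, z ≠ 0 →
      (f z)⁻¹ = z⁻¹ + a + b * z + z ^ 2 * q z := fun z hz hz0 ↦ by
    have h1 := hfq z hz
    have hf0 : f z ≠ 0 := by
      rintro h
      rw [h, zero_mul] at h1
      exact hz0 h1.symm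
    field_simp
    linear_combination -h1
  obtain ⟨C, hC⟩ := (isCompact_closedBall (0 : ℂ) (1 / 2)).exists_bound_of_continuousOn
    (hq.continuousOn.mono (closedBall_subset_ball (by norm_num)))
  have hC0 : 0 ≤ C := (norm_nonneg _).trans (hC 0 (by simp))
  set B := ‖b‖ with hB
  have hB0 : 0 ≤ B := norm_nonneg b
  set K := C + B * (B + C) with hK
  have hK0 : 0 ≤ K := by positivity
  have key : ∀ r : ℝ, 0 < r → r ≤ 1 / 2 → B * r ^ 2 < 1 → (1 + B) * ‖a‖ * r ≤ 1 →
      B ^ 2 - 1 ≤ 2 * K * r + K ^ 2 * r ^ 4 + 2 * B ^ 2 * r ^ 2 + B ^ 4 * r ^ 4 := by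
    intro r hr hr2 hBr har
    have hr1 : r < 1 := by linarith
    set c : ℂ := b * r ^ 2 with hc
    have hcn : ‖c‖ = B * r ^ 2 := by simp [hc, hB]
    set ρ := r⁻¹ + K * r ^ 2 with hρ
    have hLa : ‖subMulConj c a‖ ≤ ρ := by
      have h1 : ‖subMulConj c a‖ ≤ ‖a‖ + ‖c‖ * ‖a‖ := by
        rw [subMulConj_apply]
        exact (norm_sub_le _ _).trans (by simp)
      have h2 : (1 + B) * ‖a‖ ≤ r⁻¹ := by
        rw [← one_div, le_div_iff₀ hr]
        exact har
      have h3 : ‖c‖ * ‖a‖ ≤ B * ‖a‖ := by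
        rw [hcn]
        gcongr
        exact mul_le_of_le_one_right hB0 (pow_le_one₀ hr.le hr1.le)
      have h4 : 0 ≤ K * r ^ 2 := by positivity
      linarith
    have hcircle : ∀ z : ℂ, ‖z‖ = r → ‖subMulConj c ((f z)⁻¹ - a)‖ ≤ ρ := by
      intro z hz
      have hz0 : z ≠ 0 := norm_pos_iff.1 (hz ▸ hr)
      have hqz : ‖q z‖ ≤ C := hC z (by simpa [hz] using hr2)
      have hzc : (r : ℂ) ^ 2 * starRingEnd ℂ z⁻¹ = z := by
        have h1 := Complex.mul_conj' z
        rw [hz] at h1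
        rw [← h1, map_inv₀, mul_assoc, mul_inv_cancel₀ (by simpa using hz0), mul_one]
      have heq : subMulConj c ((f z)⁻¹ - a) =
          z⁻¹ + (z ^ 2 * q z - c * starRingEnd ℂ (b * z + z ^ 2 * q z)) := by
        rw [subMulConj_apply, hinv z (by simpa [hz] using hr1) hz0,
          show z⁻¹ + a + b * z + z ^ 2 * q z - a = z⁻¹ + (b * z + z ^ 2 * q z) by ring, map_add]
        linear_combination (-b) * hzc
      have h1 : ‖z ^ 2 * q z‖ ≤ r ^ 2 * C := by
        rw [norm_mul, norm_pow, hz]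
        gcongr
      have h2 : ‖b * z + z ^ 2 * q z‖ ≤ B + C := by
        refine (norm_add_le _ _).trans <| add_le_add ?_ <| h1.trans ?_
        · rw [norm_mul, hz]
          exact mul_le_of_le_one_right hB0 hr1.le
        · exact mul_le_of_le_one_left hC0 (pow_le_one₀ hr.le hr1.le)
      have h3 : ‖c * starRingEnd ℂ (b * z + z ^ 2 * q z)‖ ≤ B * r ^ 2 * (B + C) := by
        rw [norm_mul, hcn, RCLike.norm_conj]
        gcongr
      rw [heq]
      refine (norm_add_le _ _).trans ?_
      rw [norm_inv, hz]
      have h4 := norm_sub_le (z ^ 2 * q z) (c * starRingEnd ℂ (b * z + z ^ 2 * q z))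
      rw [hρ, hK]
      nlinarith
    let A := ball (0 : ℂ) 1 \ closedBall 0 r
    let G : ℂ → ℂ := fun z ↦ b * z + z ^ 2 * q z
    have hG : DifferentiableOn ℂ G (ball 0 1) := by fun_prop
    have hG0 : deriv G 0 = b := by
      have hq0 : HasDerivAt q (deriv q 0) 0 :=
        (hq.differentiableAt (ball_mem_nhds 0 one_pos)).hasDerivAt
      have h1 := ((hasDerivAt_id (0 : ℂ)).const_mul b).add ((hasDerivAt_pow 2 (0 : ℂ)).mul hq0)
      exact h1.deriv.trans (by simp)
    have hA0 : ∀ z ∈ A, z ≠ 0 := fun z hz h ↦ hz.2 (by simp [h, hr.le])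
    have hderiv : ∀ z ∈ A, HasDerivAt (fun z ↦ (f z)⁻¹) (-(z ^ 2)⁻¹ + deriv G z) z := by
      intro z hz
      have h1 := ((hasDerivAt_inv (hA0 z hz)).add_const a).add
        (hG.differentiableAt (isOpen_ball.mem_nhds hz.1)).hasDerivAt
      refine h1.congr_of_eventuallyEq ?_
      filter_upwards [isOpen_ball.mem_nhds hz.1, isOpen_ne.mem_nhds (hA0 z hz)] with w hw hw0
      rw [hinv w hw hw0]
      simp only [Pi.add_apply, G]
      ring
    have hlow := le_volume_image_annulus (hG.deriv isOpen_ball) hr hr1 hderiv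
      (inv_injective.comp_injOn (hinj.mono sdiff_subset))
    have hincl : (fun z ↦ (f z)⁻¹) '' A ⊆ {w : ℂ | ‖subMulConj c (w - a)‖ ≤ ρ} := by
      rintro _ ⟨z, hz, rfl⟩
      exact norm_inv_sub_le_of_annulus hf hinj h0 hr _ hLa hcircle (by simpa using hz.2)
        (by simpa using hz.1)
    have hvol := hlow.trans (measure_mono hincl)
    have hρ0 : 0 ≤ ρ := by positivity
    have hd : 0 < 1 - (B * r ^ 2) ^ 2 := by
      have : 0 ≤ B * r ^ 2 := by positivity
      nlinarith
    rw [volume_norm_subMulConj_sub_le (by rwa [hcn]) _ hρ0, hG0,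
      ENNReal.ofReal_le_ofReal_iff (by rw [hcn]; positivity), hcn, mul_div_assoc,
      mul_le_mul_iff_right₀ Real.pi_pos, le_div_iff₀ hd, hρ] at hvol
    have hx : r⁻¹ * r = 1 := inv_mul_cancel₀ hr.ne'
    have e1 : (r⁻¹ ^ 2 - 1 + B ^ 2 * (1 - r ^ 2)) * (1 - (B * r ^ 2) ^ 2) =
        r⁻¹ ^ 2 - 1 + B ^ 2 - 2 * B ^ 2 * r ^ 2 + B ^ 2 * r ^ 4 - B ^ 4 * r ^ 4 * (1 - r ^ 2) := by
      linear_combination (-(B ^ 2 * r ^ 2) * (r⁻¹ * r + 1)) * hx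
    have e2 : (r⁻¹ + K * r ^ 2) ^ 2 = r⁻¹ ^ 2 + 2 * K * r + K ^ 2 * r ^ 4 := by
      linear_combination (2 * K * r) * hx
    rw [e1, e2] at hvol
    have h5 : 0 ≤ B ^ 2 * r ^ 4 := by positivity
    have h6 : 0 ≤ B ^ 4 * r ^ 4 * r ^ 2 := by positivity
    nlinarith
  have hlim : B ^ 2 - 1 ≤ 0 := by
    have hcont : ∀ {F : ℝ → ℝ}, Continuous F → Tendsto F (𝓝[>] 0) (𝓝 (F 0)) :=
      fun hF ↦ (hF.tendsto 0).mono_left nhdsWithin_le_nhds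
    have hT := hcont (F := fun r ↦ 2 * K * r + K ^ 2 * r ^ 4 + 2 * B ^ 2 * r ^ 2 + B ^ 4 * r ^ 4)
      (by fun_prop)
    have h1 := (hcont (F := fun r ↦ B * r ^ 2) (by fun_prop)).eventually_lt_const
      (u := 1) (by simp)
    have h2 := (hcont (F := fun r ↦ (1 + B) * ‖a‖ * r) (by fun_prop)).eventually_le_const
      (u := 1) (by simp)
    have h3 := (hcont (F := fun r ↦ r) (by fun_prop)).eventually_le_const
      (u := 1 / 2) (by simp)
    refine (ge_of_tendsto hT ?_).trans_eq (by simp)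
    filter_upwards [h1, h2, h3, self_mem_nhdsWithin] with r hr1 hr2 hr3 hr
    exact key r hr hr3 hr1 hr2
  nlinarith

theorem exists_eq_add_mul_of_differentiableOn_ball {f : ℂ → ℂ}
    (hf : DifferentiableOn ℂ f (ball 0 1)) :
    ∃ g : ℂ → ℂ, DifferentiableOn ℂ g (ball 0 1) ∧ ∀ z, f z = f 0 + z * g z :=
  ⟨dslope f 0, (Complex.differentiableOn_dslope (ball_mem_nhds 0 one_pos)).2 hf, fun z ↦ by
    have := sub_smul_dslope f 0 z
    simp only [sub_zero, smul_eq_mul] at this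
    rw [this]
    ring⟩

theorem derivs_eq_of_eq_const_add_mul {f g : ℂ → ℂ} {c : ℂ}
    (hg : DifferentiableOn ℂ g (ball 0 1)) (hfg : ∀ z, f z = c + z * g z) :
    deriv f 0 = g 0 ∧ deriv (deriv f) 0 = 2 * deriv g 0 ∧
      deriv (deriv (deriv f)) 0 = 3 * deriv (deriv g) 0 := by
  have h0 : (0 : ℂ) ∈ ball (0 : ℂ) 1 := by simp
  have hasDeriv : ∀ {u : ℂ → ℂ}, DifferentiableOn ℂ u (ball 0 1) →
      ∀ z ∈ ball (0 : ℂ) 1, HasDerivAt u (deriv u z) z := fun hu z hz ↦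
    (hu.differentiableAt (isOpen_ball.mem_nhds hz)).hasDerivAt
  have hg1 := hg.deriv isOpen_ball
  have hg2 := hg1.deriv isOpen_ball
  have d1 : EqOn (deriv f) (fun z ↦ g z + z * deriv g z) (ball 0 1) := fun z hz ↦ by
    rw [funext hfg]
    exact (((hasDerivAt_id z).mul (hasDeriv hg z hz)).const_add c).deriv.trans (by simp)
  have d2 : EqOn (deriv (deriv f)) (fun z ↦ 2 * deriv g z + z * deriv (deriv g) z)
      (ball 0 1) := fun z hz ↦ by
    rw [d1.deriv isOpen_ball hz]
    refine ((hasDeriv hg z hz).add ((hasDerivAt_id z).mul (hasDeriv hg1 z hz))).deriv.trans ?_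
    simp only [id]
    ring
  have d3 : deriv (deriv (deriv f)) 0 = 3 * deriv (deriv g) 0 := by
    rw [d2.deriv isOpen_ball h0]
    refine (((hasDeriv hg1 0 h0).const_mul 2).add
      ((hasDerivAt_id 0).mul (hasDeriv hg2 0 h0))).deriv.trans ?_
    ring
  exact ⟨by simp [d1 h0], by simp [d2 h0], d3⟩

/-- **Nehari necessary condition** at the centre of the disc. -/
theorem norm_schwarzian_zero_le {f : ℂ → ℂ} (hf : DifferentiableOn ℂ f (ball 0 1))
    (hinj : InjOn f (ball 0 1)) : ‖schwarzian f 0‖ ≤ 6 := by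
  obtain ⟨f₁, hf₁, e₁⟩ := exists_eq_add_mul_of_differentiableOn_ball hf
  obtain ⟨f₂, hf₂, e₂⟩ := exists_eq_add_mul_of_differentiableOn_ball hf₁
  obtain ⟨f₃, hf₃, e₃⟩ := exists_eq_add_mul_of_differentiableOn_ball hf₂
  obtain ⟨p, hp, e₄⟩ := exists_eq_add_mul_of_differentiableOn_ball hf₃
  obtain ⟨df, ddf, dddf⟩ := derivs_eq_of_eq_const_add_mul hf₁ e₁
  obtain ⟨df₁, ddf₁, -⟩ := derivs_eq_of_eq_const_add_mul hf₂ e₂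
  obtain ⟨df₂, -, -⟩ := derivs_eq_of_eq_const_add_mul hf₃ e₃
  rcases eq_or_ne (f₁ 0) 0 with hc | hc
  · simp [schwarzian, df, hc]
  set c := f₁ 0
  set α := f₂ 0 / c with hα
  set β := f₃ 0 / c with hβ
  set b := α ^ 2 - β with hb
  have hS : schwarzian f 0 = -6 * b := by
    rw [schwarzian, dddf, ddf, df, ddf₁, df₁, df₂, hb, hα, hβ]
    ring
  let k : ℂ → ℂ := fun z ↦ f₁ z / c
  let N : ℂ → ℂ := fun z ↦ p z / c * (1 - α * z + b * z ^ 2) - α * β + α * b + β * b * z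
  have hk : ∀ z, k z = 1 + α * z + β * z ^ 2 + z ^ 3 * (p z / c) := fun z ↦ by
    simp only [k, hα, hβ]
    rw [e₂, e₃, e₄]
    field_simp
    ring
  have hk0 : ∀ z ∈ ball (0 : ℂ) 1, k z ≠ 0 := fun z hz h ↦ by
    have h1 : f₁ z = 0 := by simpa [k, hc] using h
    have h2 : f z = f 0 := by rw [e₁ z, h1, mul_zero, add_zero]
    rw [hinj hz (by simp) h2] at h1
    exact hc h1
  have hkd : DifferentiableOn ℂ k (ball 0 1) := hf₁.div_const c
  have hNd : DifferentiableOn ℂ N (ball 0 1) := by fun_prop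
  have hb1 : ‖b‖ ≤ 1 := by
    refine norm_le_one_of_injOn_ball (f := fun z ↦ (f z - f 0) / c) (q := fun z ↦ -N z / k z)
      (a := -α) ((hf.sub_const _).div_const c) (fun x hx y hy hxy ↦ hinj hx hy ?_)
      (hNd.neg.div hkd hk0) fun z hz ↦ ?_
    · simpa [div_left_inj' hc] using hxy
    · have h1 : (f z - f 0) / c = z * k z := by
        simp only [k]
        rw [e₁ z]
        ring
      have h2 := hk0 z hz
      have h3 : k z * (1 - α * z + b * z ^ 2) = 1 + z ^ 3 * N z := by
        rw [hk z]
        simp only [N, hb]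
        ring
      rw [h1]
      field_simp
      linear_combination z * h3
  rw [hS, norm_mul]
  norm_num
  linarith

theorem nehari_bound_for_gear_parameters
    (t lam : ℝ) (ht : t ∈ Set.Ioo 0 (Real.pi / 2))
    (f : ℂ → ℂ)
    (hf : DifferentiableOn ℂ f (Metric.ball 0 1))
    (hinj : Set.InjOn f (Metric.ball 0 1))
    (hS : ∀ z ∈ Metric.ball (0 : ℂ) 1, schwarzian f z = Rt t lam z) :
    -(13 - Real.cos (2 * t)) / (32 * Real.cos t) ≤ lam ∧
      lam ≤ (11 + Real.cos (2 * t)) / (32 * Real.cos t) := by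
  have hcos : 0 < Real.cos t := Real.cos_pos_of_mem_Ioo ⟨by linarith [ht.1, Real.pi_pos], ht.2⟩
  have hR : Rt t lam 0 = ((Real.sin t ^ 2 + 16 * lam * Real.cos t : ℝ) : ℂ) := by
    simp only [Rt, ψ₀t, ψ₁t]
    push_cast
    ring
  have hbound := norm_schwarzian_zero_le hf hinj
  rw [hS 0 (by simp), hR, Complex.norm_real, Real.norm_eq_abs, abs_le] at hbound
  have hcos2 : Real.cos (2 * t) = 1 - 2 * Real.sin t ^ 2 := by
    rw [Real.cos_two_mul, Real.cos_sq']
    ring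
  rw [div_le_iff₀ (by positivity), le_div_iff₀ (by positivity)]
  constructor <;> linarith [hbound.1, hbound.2]
end
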